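/- arXiv:1305.5490 — 2 statements merged into one kernel-verified Lean document; each statement's English description precedes it below -/
import Mathlib

section
/- Let γ be a continuous strictly increasing function on an interval I, and let r ≥ 1 be an integer. Then f ∘ γ is r-times γ-relative differentiable on I if and only if f is r-times differentiable on γ(I) in the classical sense; in that case, for every x ∈ I, (f ∘ γ)_γ^{(r)}(x) = (f^{(r)} ∘ γ)(x). -/
open MeasureTheory Filter Set Topology
open scoped ENNReal NNReal

noncomputable section

/-- The Laguerre weight `w_α(x) = x^α e^{-x}`. -/
def lagWeight (α x : ℝ) : ℝ := x ^ α * Real.exp (-x)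

/-- `f` has γ-relative derivative `L` at `x₀`, i.e.
`lim_{h→0} (f(x₀+h) - f(x₀)) / (γ(x₀+h) - γ(x₀)) = L`. -/
def HasGDerivAt (γ f : ℝ → ℝ) (L x₀ : ℝ) : Prop :=
  Tendsto (fun x => (f x - f x₀) / (γ x - γ x₀)) (𝓝[≠] x₀) (𝓝 L)

/-- The γ-relative derivative of `f` at `x₀` (junk value if the limit does not exist). -/
def gDeriv (γ f : ℝ → ℝ) (x₀ : ℝ) : ℝ :=
  limUnder (𝓝[≠] x₀) (fun x => (f x - f x₀) / (γ x - γ x₀))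

/-- Iterated γ-relative derivative `f_γ^{(n)}`. -/
def gIter (γ f : ℝ → ℝ) : ℕ → ℝ → ℝ
  | 0 => f
  | n + 1 => gDeriv γ (gIter γ f n)

/-- `f` is `n`-times γ-relative differentiable on `s`. -/
def GDiffOn (γ f : ℝ → ℝ) (n : ℕ) (s : Set ℝ) : Prop :=
  ∀ k < n, ∀ x ∈ s, HasGDerivAt γ (gIter γ f k) (gIter γ f (k + 1) x) x

/-- The piecewise-power part `γ₀` of the function `γ`. -/
def gamma0 (N : ℕ) (a β : ℕ → ℝ) (x : ℝ) : ℝ :=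
  (∑ k ∈ Finset.range N, |x - a k| ^ β k * Real.sign (x - a k))
    + ∑ k ∈ Finset.range N, a k ^ β k

/-- The constant `𝒞₁`. -/
def gammaC1 (N : ℕ) (a β : ℕ → ℝ) : ℝ :=
  ∑ k ∈ Finset.range N, β k * (a (N - 1) + 1 - a k) ^ (β k - 1)

/-- The constant `𝒞₂`. -/
def gammaC2 (N : ℕ) (a β : ℕ → ℝ) : ℝ :=
  (∑ k ∈ Finset.range N, (a (N - 1) + 1 - a k) ^ β k)
    - gammaC1 N a β * (a (N - 1) + 1) + ∑ k ∈ Finset.range N, a k ^ β k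

/-- The piecewise-power function `γ` of the paper (formula (3)). -/
def gammaFun (N : ℕ) (a β : ℕ → ℝ) (x : ℝ) : ℝ :=
  if x ≤ a (N - 1) + 1 then gamma0 N a β x else gammaC1 N a β * x + gammaC2 N a β

/-- The inverse of `γ` (on `[0,∞)`). -/
def gammaInv (γ : ℝ → ℝ) (y : ℝ) : ℝ := Function.invFunOn γ (Ici 0) y

/-- The weighted `L^p` norm `‖f w_α‖_{L^p(I)}` with respect to a measure `μ`. -/
def wnorm (μ : Measure ℝ) (p : ℝ≥0∞) (α : ℝ) (I : Set ℝ) (f : ℝ → ℝ) : ℝ≥0∞ :=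
  eLpNorm (fun x => f x * lagWeight α x) p (μ.restrict I)

/-- Membership in the weighted Sobolev space `W^{r,p}_γ(I)`. -/
def memW (μ : Measure ℝ) (γ : ℝ → ℝ) (r : ℕ) (p : ℝ≥0∞) (α : ℝ) (I : Set ℝ)
    (g : ℝ → ℝ) : Prop :=
  wnorm μ p α I g < ⊤ ∧ GDiffOn γ g r I ∧
    wnorm μ p α I (fun x => gIter γ g r x * Real.sqrt x ^ r) < ⊤

/-- The weighted γ-K-functional `K_{γ,r,φ}(f, t^r, L^p_{w_α}(I), W^{r,p}_γ(I))`. -/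
def Kfun (μ : Measure ℝ) (γ : ℝ → ℝ) (r : ℕ) (p : ℝ≥0∞) (α : ℝ) (I : Set ℝ)
    (f : ℝ → ℝ) (t : ℝ) : ℝ≥0∞ :=
  ⨅ g ∈ {g : ℝ → ℝ | memW μ γ r p α I g},
    wnorm μ p α I (fun x => f x - g x)
      + ENNReal.ofReal (t ^ r) * wnorm μ p α I (fun x => gIter γ g r x * Real.sqrt x ^ r)

/-- The interval `I_{rh,γ} = [4A₁r²(γ⁻¹(h))², A₂/(γ⁻¹(h))²]`. -/
def Irh (γ : ℝ → ℝ) (r : ℕ) (A1 A2 h : ℝ) : Set ℝ :=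
  Icc (4 * A1 * (r : ℝ) ^ 2 * gammaInv γ h ^ 2) (A2 / gammaInv γ h ^ 2)

/-- The restricted γ-K-functional `K̃_{γ,r,φ}(f, t^r, L^p_{w_α}, W^{r,p}_γ)`. -/
def Ktilde (μ : Measure ℝ) (γ : ℝ → ℝ) (r : ℕ) (p : ℝ≥0∞) (α A1 A2 : ℝ)
    (f : ℝ → ℝ) (t : ℝ) : ℝ≥0∞ :=
  ⨆ h ∈ Ioc (0 : ℝ) t, Kfun μ γ r p α (Irh γ r A1 A2 h) f h

/-- The forward difference `Δ⃗^r_{γ,φ,h} f(x)`. -/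
def gDelta (γ : ℝ → ℝ) (r : ℕ) (h : ℝ) (f : ℝ → ℝ) (x : ℝ) : ℝ :=
  ∑ k ∈ Finset.range (r + 1),
    (-1 : ℝ) ^ (r - k) * (r.choose k : ℝ) * f (x + k * gammaInv γ h * Real.sqrt x)

/-- The main part of the γ-modulus of smoothness `Ω^r_{γ,φ}(f,t)_{w_α,p}`. -/
def Omega (μ : Measure ℝ) (γ : ℝ → ℝ) (r : ℕ) (p : ℝ≥0∞) (α A1 A2 : ℝ)
    (f : ℝ → ℝ) (t : ℝ) : ℝ≥0∞ :=
  ⨆ h ∈ Ioc (0 : ℝ) t, wnorm μ p α (Irh γ r A1 A2 h) (gDelta γ r h f)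

/-- The complete γ-modulus of smoothness `ω^r_{γ,φ}(f,t)_{w_α,p}`. -/
def omegaFull (μ : Measure ℝ) (γ : ℝ → ℝ) (r : ℕ) (p : ℝ≥0∞) (α A1 A2 : ℝ)
    (f : ℝ → ℝ) (t : ℝ) : ℝ≥0∞ :=
  Omega μ γ r p α A1 A2 f t
    + ⨅ q ∈ {q : Polynomial ℝ | q.degree < (r : ℕ)},
        wnorm μ p α (Ioo 0 (4 * A1 * (r : ℝ) ^ 2 * gammaInv γ t ^ 2))
          (fun x => f x - q.eval (γ x))
    + ⨅ q ∈ {q : Polynomial ℝ | q.degree < (r : ℕ)},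
        wnorm μ p α (Ioi (A2 / gammaInv γ t ^ 2)) (fun x => f x - q.eval (γ x))


theorem map_nhds_of_strictMonoOn_Ioo {γ : ℝ → ℝ} {c d x : ℝ} (hγm : StrictMonoOn γ (Ioo c d))
    (hγc : ContinuousOn γ (Ioo c d)) (hx : x ∈ Ioo c d) : map γ (𝓝 x) = 𝓝 (γ x) := by
  refine le_antisymm (hγc.continuousAt (isOpen_Ioo.mem_nhds hx)) fun s hs => ?_
  obtain ⟨a, b, hab, hnhds, hsub⟩ :=
    exists_Icc_mem_subset_of_mem_nhds (inter_mem (mem_map.1 hs) (isOpen_Ioo.mem_nhds hx))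
  have hIoo : Icc a b ⊆ Ioo c d := fun y hy => (hsub hy).2
  have hxab : x ∈ Ioo a b := by rwa [← interior_Icc, mem_interior_iff_mem_nhds]
  have hle : a ≤ b := hab.1.trans hab.2
  have ha : γ a < γ x := hγm (hIoo (left_mem_Icc.2 hle)) hx hxab.1
  have hb : γ x < γ b := hγm hx (hIoo (right_mem_Icc.2 hle)) hxab.2
  filter_upwards [Icc_mem_nhds ha hb] with y hy
  obtain ⟨z, hz, rfl⟩ := intermediate_value_Icc hle (hγc.mono hIoo) hy
  exact (hsub hz).1

theorem map_nhdsNE_of_strictMonoOn_Ioo {γ : ℝ → ℝ} {c d x : ℝ} (hγm : StrictMonoOn γ (Ioo c d))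
    (hγc : ContinuousOn γ (Ioo c d)) (hx : x ∈ Ioo c d) : map γ (𝓝[≠] x) = 𝓝[≠] (γ x) := by
  have hmap := map_nhds_of_strictMonoOn_Ioo hγm hγc hx
  refine le_antisymm ?_ fun s hs => ?_
  · refine tendsto_nhdsWithin_iff.2 ⟨hmap.le.trans' (map_mono nhdsWithin_le_nhds), ?_⟩
    filter_upwards [self_mem_nhdsWithin, nhdsWithin_le_nhds (isOpen_Ioo.mem_nhds hx)] with y hne hy
    exact fun h => hne (hγm.injOn hy hx h)
  · rw [← insert_mem_nhds_iff, ← hmap, mem_map]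
    filter_upwards [insert_mem_nhds_iff.2 (mem_map.1 hs)] with y hy
    rcases hy with rfl | hy
    exacts [mem_insert _ _, mem_insert_of_mem _ hy]

theorem isOpen_image_Ioo_of_strictMonoOn {γ : ℝ → ℝ} {c d : ℝ} (hγm : StrictMonoOn γ (Ioo c d))
    (hγc : ContinuousOn γ (Ioo c d)) : IsOpen (γ '' Ioo c d) := by
  refine isOpen_iff_mem_nhds.2 ?_
  rintro _ ⟨x, hx, rfl⟩
  rw [← map_nhds_of_strictMonoOn_Ioo hγm hγc hx]
  exact image_mem_map (isOpen_Ioo.mem_nhds hx)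

theorem hasGDerivAt_iff_hasDerivAt {γ g F : ℝ → ℝ} {c d x L : ℝ}
    (hγm : StrictMonoOn γ (Ioo c d)) (hγc : ContinuousOn γ (Ioo c d)) (hx : x ∈ Ioo c d)
    (hg : ∀ y ∈ Ioo c d, g y = F (γ y)) : HasGDerivAt γ g L x ↔ HasDerivAt F L (γ x) := by
  rw [hasDerivAt_iff_tendsto_slope, ← map_nhdsNE_of_strictMonoOn_Ioo hγm hγc hx,
    tendsto_map'_iff, HasGDerivAt]
  refine tendsto_congr' ?_
  filter_upwards [nhdsWithin_le_nhds (isOpen_Ioo.mem_nhds hx)] with y hy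
  rw [hg y hy, hg x hx, Function.comp_apply, slope_def_field]

theorem HasGDerivAt.gDeriv_eq {γ g : ℝ → ℝ} {x L : ℝ} (h : HasGDerivAt γ g L x) :
    gDeriv γ g x = L :=
  h.limUnder_eq

theorem gDiffOn_succ {γ g : ℝ → ℝ} {n : ℕ} {s : Set ℝ} :
    GDiffOn γ g (n + 1) s ↔
      GDiffOn γ g n s ∧ ∀ x ∈ s, HasGDerivAt γ (gIter γ g n) (gIter γ g (n + 1) x) x :=
  Nat.forall_lt_succ_right

/-- Statement 4: `f ∘ γ` is `r`-times γ-relative differentiable on `I` iff `f` is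
`r`-times differentiable on `γ(I)`, and then `(f ∘ γ)_γ^{(r)} = f^{(r)} ∘ γ` on `I`. -/
theorem gIter_comp_gamma
    (γ : ℝ → ℝ) (c d : ℝ) (hγm : StrictMonoOn γ (Ioo c d))
    (hγc : ContinuousOn γ (Ioo c d)) (f : ℝ → ℝ) (r : ℕ) (hr : 1 ≤ r) :
    (GDiffOn γ (f ∘ γ) r (Ioo c d) ↔
      ∀ k < r, DifferentiableOn ℝ
        (iteratedDerivWithin k f (γ '' Ioo c d)) (γ '' Ioo c d)) ∧
    (GDiffOn γ (f ∘ γ) r (Ioo c d) →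
      ∀ x ∈ Ioo c d,
        gIter γ (f ∘ γ) r x = iteratedDerivWithin r f (γ '' Ioo c d) (γ x)) := by
  clear hr
  have hopen := isOpen_image_Ioo_of_strictMonoOn hγm hγc
  induction r with
  | zero =>
    refine ⟨⟨fun _ k hk => absurd hk k.not_lt_zero, fun _ k hk => absurd hk k.not_lt_zero⟩,
      fun _ x _ => ?_⟩
    rw [iteratedDerivWithin_zero]
    rfl
  | succ n ih =>
    obtain ⟨ihiff, iheq⟩ := ih
    refine ⟨?_, fun h x hx => ?_⟩
    · rw [gDiffOn_succ, Nat.forall_lt_succ_right, ← ihiff]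
      refine and_congr_right fun hn => ⟨?_, fun h x hx => ?_⟩
      · rintro h _ ⟨x, hx, rfl⟩
        exact ((hasGDerivAt_iff_hasDerivAt hγm hγc hx (iheq hn)).1
          (h x hx)).differentiableAt.differentiableWithinAt
      · have hγx := hopen.mem_nhds (mem_image_of_mem γ hx)
        have hG := (hasGDerivAt_iff_hasDerivAt hγm hγc hx (iheq hn)).2
          (h.differentiableAt hγx).hasDerivAt
        rwa [← hG.gDeriv_eq] at hG
    · obtain ⟨hn, hG⟩ := gDiffOn_succ.1 h
      rw [iteratedDerivWithin_succ, derivWithin_of_isOpen hopen (mem_image_of_mem γ hx)]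
      exact ((hasGDerivAt_iff_hasDerivAt hγm hγc hx (iheq hn)).1 (hG x hx)).deriv.symm
end
end

section
/- Let γ be the piecewise-power function constructed below with exponents β_k ∈ (0, 1). Then for every 0 ≤ x ≤ γ(a₁) one has (a₁/γ(a₁)) · x ≤ γ⁻¹(x) ≤ x / (Σ_{k=1}^N β_k a_k^{β_k − 1}). -/
open MeasureTheory Filter Set Topology
open scoped ENNReal NNReal

noncomputable section

/-- The odd extension `t ↦ |t|^b sgn t` of a power with positive exponent is strictly increasing. -/
theorem strictMono_abs_rpow_mul_sign {b : ℝ} (hb : 0 < b) :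
    StrictMono fun t : ℝ => |t| ^ b * Real.sign t := by
  intro s t hst
  have hneg : ∀ r : ℝ, r < 0 → |r| ^ b * Real.sign r = -(-r) ^ b := fun r hr => by
    rw [abs_of_neg hr, Real.sign_of_neg hr, mul_neg_one]
  have hnonneg : ∀ r : ℝ, 0 ≤ r → |r| ^ b * Real.sign r = r ^ b := fun r hr => by
    rcases hr.eq_or_lt with rfl | hr'
    · simp [Real.zero_rpow hb.ne']
    · rw [abs_of_pos hr', Real.sign_of_pos hr', mul_one]
  dsimp only
  rcases lt_or_ge s 0 with hs | hs
  · rw [hneg s hs]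
    rcases lt_or_ge t 0 with ht | ht
    · rw [hneg t ht]
      exact neg_lt_neg (Real.rpow_lt_rpow (by linarith) (by linarith) hb)
    · rw [hnonneg t ht]
      linarith [Real.rpow_pos_of_pos (neg_pos.2 hs) b, Real.rpow_nonneg ht b]
  · rw [hnonneg s hs, hnonneg t (hs.trans hst.le)]
    exact Real.rpow_lt_rpow hs hst hb

/-- Tangent line bound at `0` for `u ↦ (c - u)^b`. -/
theorem sub_rpow_le_rpow_sub_mul {b c u : ℝ} (hb0 : 0 ≤ b) (hb1 : b ≤ 1) (hc : 0 < c)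
    (hu : u ≤ c) : (c - u) ^ b ≤ c ^ b - b * c ^ (b - 1) * u := by
  have hs : -1 ≤ -(u / c) := by
    rw [neg_le_neg_iff, div_le_one hc]
    exact hu
  have hfactor : c - u = c * (1 + -(u / c)) := by
    field_simp
    ring
  calc (c - u) ^ b = c ^ b * (1 + -(u / c)) ^ b := by
        rw [hfactor, Real.mul_rpow hc.le (by linarith)]
    _ ≤ c ^ b * (1 + b * -(u / c)) :=
        mul_le_mul_of_nonneg_left (rpow_one_add_le_one_add_mul_self hs hb0 hb1)
          (Real.rpow_nonneg hc.le b)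
    _ = c ^ b - b * c ^ (b - 1) * u := by
        rw [Real.rpow_sub_one hc.ne']
        ring

/-- Chord bound on `[0, d]` for `u ↦ (c - u)^b`. -/
theorem rpow_sub_sub_rpow_le_div_mul {b c d u : ℝ} (hb0 : 0 ≤ b) (hb1 : b ≤ 1) (hd : 0 < d)
    (hdc : d ≤ c) (hu0 : 0 ≤ u) (hud : u ≤ d) :
    c ^ b - (c - u) ^ b ≤ u / d * (c ^ b - (c - d) ^ b) := by
  have hle : u / d ≤ 1 := (div_le_one hd).2 hud
  have h := (Real.concaveOn_rpow hb0 hb1).2 (mem_Ici.2 (hd.le.trans hdc))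
    (mem_Ici.2 (sub_nonneg.2 hdc)) (sub_nonneg.2 hle) (div_nonneg hu0 hd.le) (by ring)
  have hpoint : (1 - u / d) * c + u / d * (c - d) = c - u := by
    field_simp
    ring
  simp only [smul_eq_mul, hpoint] at h
  linarith

section Gamma

variable {N : ℕ} {a β : ℕ → ℝ}

theorem strictMono_gamma0 (hN : 1 ≤ N) (hβ : ∀ k < N, 0 < β k) :
    StrictMono (gamma0 N a β) := by
  intro s t hst
  refine add_lt_add_left (Finset.sum_lt_sum_of_nonempty ⟨0, Finset.mem_range.2 hN⟩ ?_) _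
  intro k hk
  exact strictMono_abs_rpow_mul_sign (hβ k (Finset.mem_range.1 hk))
    (sub_lt_sub_right hst (a k))

theorem gamma0_eq_sum_of_le (hβ : ∀ k < N, 0 < β k) {u : ℝ} (hu : ∀ k < N, u ≤ a k) :
    gamma0 N a β u = ∑ k ∈ Finset.range N, (a k ^ β k - (a k - u) ^ β k) := by
  rw [gamma0, ← Finset.sum_add_distrib]
  refine Finset.sum_congr rfl fun k hk => ?_
  have hk := Finset.mem_range.1 hk
  rcases (hu k hk).eq_or_lt with h | h
  · simp [h, Real.zero_rpow (hβ k hk).ne']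
  · rw [Real.sign_of_neg (sub_neg.2 h), abs_of_neg (sub_neg.2 h), neg_sub]
    ring

theorem gamma0_last_add_one (hlast : ∀ k < N, a k ≤ a (N - 1)) :
    gamma0 N a β (a (N - 1) + 1)
      = gammaC1 N a β * (a (N - 1) + 1) + gammaC2 N a β := by
  have hsum : ∑ k ∈ Finset.range N,
        |a (N - 1) + 1 - a k| ^ β k * Real.sign (a (N - 1) + 1 - a k)
      = ∑ k ∈ Finset.range N, (a (N - 1) + 1 - a k) ^ β k := by
    refine Finset.sum_congr rfl fun k hk => ?_
    have hpos : 0 < a (N - 1) + 1 - a k := by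
      linarith [hlast k (Finset.mem_range.1 hk)]
    rw [abs_of_pos hpos, Real.sign_of_pos hpos, mul_one]
  rw [gamma0, hsum, gammaC2]
  ring

theorem gammaC1_pos (hN : 1 ≤ N) (hβ : ∀ k < N, 0 < β k)
    (hlast : ∀ k < N, a k ≤ a (N - 1)) : 0 < gammaC1 N a β := by
  refine Finset.sum_pos (fun k hk => ?_) ⟨0, Finset.mem_range.2 hN⟩
  have hk := Finset.mem_range.1 hk
  exact mul_pos (hβ k hk) (Real.rpow_pos_of_pos (by linarith [hlast k hk]) _)

theorem strictMono_gammaFun (hN : 1 ≤ N) (hβ : ∀ k < N, 0 < β k)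
    (hlast : ∀ k < N, a k ≤ a (N - 1)) : StrictMono (gammaFun N a β) := by
  intro s t hst
  have h0 := strictMono_gamma0 (a := a) hN hβ
  have hC := gammaC1_pos hN hβ hlast
  have hA := gamma0_last_add_one (β := β) hlast
  unfold gammaFun
  split_ifs with hs ht ht
  · exact h0 hst
  · have h1 := h0.monotone hs
    have h2 := mul_lt_mul_of_pos_left (not_le.1 ht) hC
    linarith
  · exact absurd (hst.le.trans ht) hs
  · linarith [mul_lt_mul_of_pos_left hst hC]

end Gamma

/-- Formula (7): for `0 ≤ x ≤ γ(a₁)` one has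
`(a₁/γ(a₁)) x ≤ γ⁻¹(x) ≤ x / (Σ_k β_k a_k^{β_k - 1})`. -/
theorem gammaInv_bounds
    (N : ℕ) (hN : 1 ≤ N) (a β : ℕ → ℝ) (ha : 0 < a 0)
    (hmono : ∀ i j, i < j → j < N → a i < a j)
    (hβ : ∀ k < N, 0 < β k ∧ β k < 1) :
    ∀ x ∈ Icc (0 : ℝ) (gammaFun N a β (a 0)),
      a 0 / gammaFun N a β (a 0) * x ≤ gammaInv (gammaFun N a β) x ∧
        gammaInv (gammaFun N a β) x ≤
          x / ∑ k ∈ Finset.range N, β k * a k ^ (β k - 1) := by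
  intro x hx
  have hβ0 : ∀ k < N, 0 < β k := fun k hk => (hβ k hk).1
  have hle : ∀ i j, i ≤ j → j < N → a i ≤ a j := fun i j hij hj => by
    rcases hij.eq_or_lt with rfl | h
    · exact le_rfl
    · exact (hmono i j h hj).le
  have hfirst : ∀ k < N, a 0 ≤ a k := fun k hk => hle 0 k k.zero_le hk
  have hlast : ∀ k < N, a k ≤ a (N - 1) := fun k hk => hle k (N - 1) (by omega) (by omega)
  have hsm := strictMono_gammaFun hN hβ0 hlast
  have heq : ∀ u ≤ a 0, gammaFun N a β u
      = ∑ k ∈ Finset.range N, (a k ^ β k - (a k - u) ^ β k) := fun u hu => by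
    rw [gammaFun, if_pos (by linarith [hlast 0 hN]),
      gamma0_eq_sum_of_le hβ0 fun k hk => hu.trans (hfirst k hk)]
  have hzero : gammaFun N a β 0 = 0 := by simp [heq 0 ha.le]
  have hcont : ContinuousOn (gammaFun N a β) (Icc 0 (a 0)) := by
    refine ContinuousOn.congr ?_ fun u hu => heq u hu.2
    refine continuousOn_finsetSum _ fun k hk => ?_
    exact continuousOn_const.sub ((continuousOn_const.sub continuousOn_id).rpow_const
      fun _ _ => Or.inr (hβ0 k (Finset.mem_range.1 hk)).le)
  have hex : ∃ u ∈ Ici (0 : ℝ), gammaFun N a β u = x := by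
    obtain ⟨u, hu, hux⟩ := intermediate_value_Icc ha.le hcont (by rwa [hzero])
    exact ⟨u, hu.1, hux⟩
  have hu0 : 0 ≤ gammaInv (gammaFun N a β) x := Function.invFunOn_mem hex
  have hux : gammaFun N a β (gammaInv (gammaFun N a β) x) = x := Function.invFunOn_eq hex
  generalize gammaInv (gammaFun N a β) x = u at hu0 hux ⊢
  have hua : u ≤ a 0 := hsm.le_iff_le.1 (hux.trans_le hx.2)
  have hγpos : 0 < gammaFun N a β (a 0) := hzero ▸ hsm ha
  constructor
  · have hchord : x ≤ u / a 0 * gammaFun N a β (a 0) := by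
      rw [← hux, heq u hua, heq (a 0) le_rfl, Finset.mul_sum]
      refine Finset.sum_le_sum fun k hk => ?_
      have hk := Finset.mem_range.1 hk
      exact rpow_sub_sub_rpow_le_div_mul (hβ k hk).1.le (hβ k hk).2.le ha (hfirst k hk) hu0 hua
    calc a 0 / gammaFun N a β (a 0) * x
        ≤ a 0 / gammaFun N a β (a 0) * (u / a 0 * gammaFun N a β (a 0)) :=
          mul_le_mul_of_nonneg_left hchord (div_pos ha hγpos).le
      _ = u := by
          field_simp
  · have hslope : 0 < ∑ k ∈ Finset.range N, β k * a k ^ (β k - 1) := by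
      refine Finset.sum_pos (fun k hk => ?_) ⟨0, Finset.mem_range.2 hN⟩
      have hk := Finset.mem_range.1 hk
      exact mul_pos (hβ0 k hk) (Real.rpow_pos_of_pos (ha.trans_le (hfirst k hk)) _)
    rw [le_div_iff₀ hslope, ← hux, heq u hua, Finset.mul_sum]
    refine Finset.sum_le_sum fun k hk => ?_
    have hk := Finset.mem_range.1 hk
    linarith [sub_rpow_le_rpow_sub_mul (hβ k hk).1.le (hβ k hk).2.le
      (ha.trans_le (hfirst k hk)) (hua.trans (hfirst k hk))]
end
end
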